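/- Theorem 4.1, second estimate (nodal L₂ error of dG(q) for the displacement). Let q ≥ 0 be an integer. There is a constant C > 0, independent of T, N and the mesh, such that the error e₁ := U₁ − u₁ between the dG(q) approximation and the exact solution satisfies ‖e_{1,N}^−‖ ≤ C Σ_{n=1}^N k_n^{q+1} ∫_{I_n} ( ‖u₂^{(q+1)}(t)‖ + ‖u₁^{(q+1)}(t)‖₁ ) dt, provided u₁^{(q+1)} ∈ L¹((0,T);Ḣ¹) and u₂^{(q+1)} ∈ L¹((0,T);H). -/

import Mathlib

noncomputable section

open scoped RealInnerProductSpace BigOperators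
open MeasureTheory

/-- Squared fractional-order norm `‖v‖_α² = Σ_k λ_k^α (v,φ_k)²`. -/
def hsNormSq {H : Type*} [NormedAddCommGroup H] [InnerProductSpace ℝ H]
    (φ : ℕ → H) (lam : ℕ → ℝ) (α : ℝ) (v : H) : ℝ :=
  ∑' k, lam k ^ α * ⟪v, φ k⟫ ^ 2

/-- Fractional-order norm `‖v‖_α`. -/
def hsNorm {H : Type*} [NormedAddCommGroup H] [InnerProductSpace ℝ H]
    (φ : ℕ → H) (lam : ℕ → ℝ) (α : ℝ) (v : H) : ℝ :=
  Real.sqrt (hsNormSq φ lam α v)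

/-- Membership in the fractional-order space `Ḣ^α`. -/
def MemHs {H : Type*} [NormedAddCommGroup H] [InnerProductSpace ℝ H]
    (φ : ℕ → H) (lam : ℕ → ℝ) (α : ℝ) (v : H) : Prop :=
  Summable (fun k => lam k ^ α * ⟪v, φ k⟫ ^ 2)

/-- Weighted spectral pairing `Σ_k λ_k^l (u,φ_k)(v,φ_k)`.
`aPow φ lam 1 u v = a(u,v)`, `aPow φ lam (l+1) u v = a(u, A^l v)` and
`aPow φ lam l u v = (u, A^l v)`. -/
def aPow {H : Type*} [NormedAddCommGroup H] [InnerProductSpace ℝ H]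
    (φ : ℕ → H) (lam : ℕ → ℝ) (l : ℝ) (u v : H) : ℝ :=
  ∑' k, lam k ^ l * ⟪u, φ k⟫ * ⟪v, φ k⟫

/-- The energy bilinear form `a(u,v) = Σ_k λ_k (u,φ_k)(v,φ_k)`. -/
def aForm {H : Type*} [NormedAddCommGroup H] [InnerProductSpace ℝ H]
    (φ : ℕ → H) (lam : ℕ → ℝ) (u v : H) : ℝ :=
  aPow φ lam 1 u v

/-- The operator `A`, determined by `A φ_k = λ_k φ_k`. -/
def Aop {H : Type*} [NormedAddCommGroup H] [InnerProductSpace ℝ H]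
    (φ : ℕ → H) (lam : ℕ → ℝ) (v : H) : H :=
  ∑' k, (lam k * ⟪v, φ k⟫) • φ k

/-- Value at time `s` of the polynomial of degree ≤ q (with coefficients `c n ·`)
attached to the `n`-th time subinterval. -/
def pval {H : Type*} [NormedAddCommGroup H] [InnerProductSpace ℝ H]
    (q : ℕ) (c : ℕ → ℕ → H) (n : ℕ) (s : ℝ) : H :=
  ∑ j ∈ Finset.range (q + 1), s ^ j • c n j

/-- Time derivative of `pval`. -/
def pderiv {H : Type*} [NormedAddCommGroup H] [InnerProductSpace ℝ H]
    (q : ℕ) (c : ℕ → ℕ → H) (n : ℕ) (s : ℝ) : H :=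
  ∑ j ∈ Finset.range (q + 1), ((j : ℝ) * s ^ (j - 1)) • c n j

/-- The dG bilinear form `B((u₁,u₂),(v₁,v₂))`, where the piecewise polynomials
`u₁, u₂, v₁, v₂` are described by their coefficient families `c1, c2, d1, d2`
(on the mesh `0 = tt 0 < tt 1 < ⋯ < tt N`). -/
def Bform {H : Type*} [NormedAddCommGroup H] [InnerProductSpace ℝ H]
    (φ : ℕ → H) (lam : ℕ → ℝ) (tt : ℕ → ℝ) (N q : ℕ)
    (c1 c2 d1 d2 : ℕ → ℕ → H) : ℝ :=
  (∑ n ∈ Finset.Icc 1 N, ∫ s in tt (n-1)..tt n,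
      (aForm φ lam (pderiv q c1 n s) (pval q d1 n s)
        - aForm φ lam (pval q c2 n s) (pval q d1 n s)
        + ⟪pderiv q c2 n s, pval q d2 n s⟫
        + aForm φ lam (pval q c1 n s) (pval q d2 n s)))
  + (∑ n ∈ Finset.Icc 1 (N-1),
      (aForm φ lam (pval q c1 (n+1) (tt n) - pval q c1 n (tt n)) (pval q d1 (n+1) (tt n))
        + ⟪pval q c2 (n+1) (tt n) - pval q c2 n (tt n), pval q d2 (n+1) (tt n)⟫))
  + aForm φ lam (pval q c1 1 (tt 0)) (pval q d1 1 (tt 0))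
  + ⟪pval q c2 1 (tt 0), pval q d2 1 (tt 0)⟫

/-- Supremum of `g` over the open interval `(a,b)`. -/
def supIoo (g : ℝ → ℝ) (a b : ℝ) : ℝ :=
  sSup (g '' Set.Ioo a b)

/-- Squared discrete fractional norm `‖v‖_{h,s}² = ‖A_h^{s/2} v‖²`, expressed through
an orthonormal eigenbasis `e` of `A_h` on `S_h` with eigenvalues `μ`. -/
def hNormSqh {H : Type*} [NormedAddCommGroup H] [InnerProductSpace ℝ H]
    {m : ℕ} (e : Fin m → H) (μ : Fin m → ℝ) (s : ℝ) (v : H) : ℝ :=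
  ∑ i, μ i ^ s * ⟪v, e i⟫ ^ 2

/-- Discrete fractional norm `‖v‖_{h,s}`. -/
def hNormh {H : Type*} [NormedAddCommGroup H] [InnerProductSpace ℝ H]
    {m : ℕ} (e : Fin m → H) (μ : Fin m → ℝ) (s : ℝ) (v : H) : ℝ :=
  Real.sqrt (hNormSqh e μ s v)

/-- Discrete weighted pairing: `aPowh e μ (l+1) u v = a(u, A_h^l v)` and
`aPowh e μ l u v = (u, A_h^l v)` for `u, v ∈ S_h`. -/
def aPowh {H : Type*} [NormedAddCommGroup H] [InnerProductSpace ℝ H]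
    {m : ℕ} (e : Fin m → H) (μ : Fin m → ℝ) (l : ℝ) (u v : H) : ℝ :=
  ∑ i, μ i ^ l * ⟪u, e i⟫ * ⟪v, e i⟫

/-- `f` is a polynomial function of degree less than `n` with coefficients in `E`. -/
def IsPolyFun {E : Type*} [NormedAddCommGroup E] [NormedSpace ℝ E] (n : ℕ) (f : ℝ → E) : Prop :=
  ∃ c : ℕ → E, ∀ s, f s = ∑ j ∈ Finset.range n, s ^ j • c j

namespace IsPolyFun

variable {E F : Type*} [NormedAddCommGroup E] [NormedSpace ℝ E]
  [NormedAddCommGroup F] [NormedSpace ℝ F] {n : ℕ} {f g : ℝ → E}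

lemma continuous (hf : IsPolyFun n f) : Continuous f := by
  obtain ⟨c, hc⟩ := hf
  rw [funext hc]
  fun_prop

lemma zero : IsPolyFun n (fun _ => (0 : E)) := ⟨fun _ => 0, by simp⟩

lemma add (hf : IsPolyFun n f) (hg : IsPolyFun n g) : IsPolyFun n (fun s => f s + g s) := by
  obtain ⟨c, hc⟩ := hf
  obtain ⟨d, hd⟩ := hg
  exact ⟨fun j => c j + d j, fun s => by simp [hc, hd, Finset.sum_add_distrib]⟩

lemma map (L : E →L[ℝ] F) (hf : IsPolyFun n f) : IsPolyFun n (fun s => L (f s)) := by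
  obtain ⟨c, hc⟩ := hf
  exact ⟨fun j => L (c j), fun s => by simp [hc]⟩

lemma sub (hf : IsPolyFun n f) (hg : IsPolyFun n g) : IsPolyFun n (fun s => f s - g s) := by
  simpa [sub_eq_add_neg] using hf.add (hg.map (-ContinuousLinearMap.id ℝ E))

lemma sum {ι : Type*} (S : Finset ι) {h : ι → ℝ → E} (hh : ∀ i ∈ S, IsPolyFun n (h i)) :
    IsPolyFun n (fun s => ∑ i ∈ S, h i s) := by
  classical
  induction S using Finset.induction_on with
  | empty => simpa using zero
  | insert i S hi ih =>
    simp only [Finset.sum_insert hi]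
    exact (hh i (by simp)).add (ih fun j hj => hh j (by simp [hj]))

lemma mono {m : ℕ} (hf : IsPolyFun n f) (hnm : n ≤ m) : IsPolyFun m f := by
  obtain ⟨c, hc⟩ := hf
  refine ⟨fun j => if j < n then c j else 0, fun s => ?_⟩
  rw [hc, ← Finset.sum_subset (Finset.range_subset_range.2 hnm)]
  · exact Finset.sum_congr rfl fun j hj => by simp [Finset.mem_range.1 hj]
  · intro j _ hj
    simp [Finset.mem_range.not.1 hj]

lemma const (v : E) : IsPolyFun (n + 1) (fun _ => v) :=
  mono (n := 1) ⟨fun _ => v, fun s => by simp⟩ (by omega)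

lemma smul_const {p : ℝ → ℝ} (hp : IsPolyFun n p) (v : E) : IsPolyFun n (fun s => p s • v) :=
  hp.map (ContinuousLinearMap.toSpanSingleton ℝ v)

lemma id_smul (hf : IsPolyFun n f) : IsPolyFun (n + 1) (fun s => s • f s) := by
  obtain ⟨c, hc⟩ := hf
  refine ⟨fun j => if j = 0 then 0 else c (j - 1), fun s => ?_⟩
  rw [Finset.sum_range_succ']
  simp [hc, Finset.smul_sum, pow_succ', mul_smul]

lemma const_smul (hf : IsPolyFun n f) (r : ℝ) : IsPolyFun n (fun s => r • f s) :=
  hf.map (r • ContinuousLinearMap.id ℝ E)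

lemma affine_pow (a k : ℝ) (j : ℕ) : IsPolyFun (j + 1) (fun s : ℝ => (a + k * s) ^ j) := by
  induction j with
  | zero => simpa using const (n := 0) (1 : ℝ)
  | succ j ih =>
    have h := ((ih.const_smul a).mono (Nat.le_succ _)).add ((ih.const_smul k).id_smul)
    convert h using 2 with s
    simp only [smul_eq_mul]
    ring

lemma comp_affine (hf : IsPolyFun n f) (a k : ℝ) : IsPolyFun n (fun s => f (a + k * s)) := by
  obtain ⟨c, hc⟩ := hf
  simp only [hc]
  exact sum _ fun j hj =>
    ((affine_pow a k j).mono (Nat.succ_le_of_lt (Finset.mem_range.1 hj))).smul_const (c j)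

lemma exists_deriv (hf : IsPolyFun (n + 1) f) :
    ∃ f', IsPolyFun n f' ∧ ∀ s, HasDerivAt f (f' s) s := by
  obtain ⟨c, hc⟩ := hf
  refine ⟨fun s => ∑ j ∈ Finset.range n, s ^ j • (((j : ℝ) + 1) • c (j + 1)),
    ⟨fun j => ((j : ℝ) + 1) • c (j + 1), fun s => rfl⟩, fun s => ?_⟩
  rw [funext hc]
  have h : HasDerivAt (fun s : ℝ => ∑ j ∈ Finset.range (n + 1), s ^ j • c j)
      (∑ j ∈ Finset.range (n + 1), ((j : ℝ) * s ^ (j - 1)) • c j) s :=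
    HasDerivAt.fun_sum fun j _ => (hasDerivAt_pow j s).smul_const (c j)
  convert h using 1
  rw [Finset.sum_range_succ']
  simp [smul_smul, mul_comm]

lemma exists_primitive (hf : IsPolyFun n f) :
    ∃ F, IsPolyFun (n + 1) F ∧ ∀ s, HasDerivAt F (f s) s := by
  obtain ⟨c, hc⟩ := hf
  refine ⟨fun s => ∑ j ∈ Finset.range n, s ^ (j + 1) • ((((j : ℝ) + 1)⁻¹) • c j),
    ⟨fun j => if j = 0 then 0 else (((j - 1 : ℕ) : ℝ) + 1)⁻¹ • c (j - 1), fun s => ?_⟩,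
    fun s => ?_⟩
  · rw [Finset.sum_range_succ']
    simp
  · rw [hc]
    refine HasDerivAt.fun_sum fun j _ => ?_
    convert (hasDerivAt_pow (j + 1) s).smul_const ((((j : ℝ) + 1)⁻¹) • c j) using 1
    rw [smul_smul]
    congr 1
    have : (j : ℝ) + 1 ≠ 0 := by positivity
    push_cast
    field_simp

end IsPolyFun

/-- Gram-dual polynomials of the monomials for a weight that is positive on `(0,1)`. -/
lemma exists_dual_polyFun (w : ℝ → ℝ) (hw : Continuous w) (hpos : ∀ s ∈ Set.Ioo (0 : ℝ) 1, 0 < w s)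
    (hnn : ∀ s ∈ Set.Icc (0 : ℝ) 1, 0 ≤ w s) (n : ℕ) :
    ∃ r : ℕ → ℝ → ℝ, (∀ j, IsPolyFun n (r j)) ∧ ∀ j < n, ∀ i < n,
      ∫ s in (0 : ℝ)..1, w s * (r j s * s ^ i) = if i = j then 1 else 0 := by
  let M : Matrix (Fin n) (Fin n) ℝ := fun i j =>
    ∫ s in (0 : ℝ)..1, w s * (s ^ (j : ℕ) * s ^ (i : ℕ))
  have hM : ∀ (c : Fin n → ℝ) (i : Fin n), M.mulVec c i =
      ∫ s in (0 : ℝ)..1, w s * ((∑ j : Fin n, s ^ (j : ℕ) * c j) * s ^ (i : ℕ)) := by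
    intro c i
    simp only [Matrix.mulVec, dotProduct, M, ← intervalIntegral.integral_mul_const]
    rw [← intervalIntegral.integral_finsetSum]
    · refine intervalIntegral.integral_congr fun s _ => ?_
      simp only [Finset.sum_mul, Finset.mul_sum]
      exact Finset.sum_congr rfl fun j _ => by ring
    · intro j _
      exact Continuous.intervalIntegrable (by fun_prop) _ _
  have hinj : Function.Injective M.mulVecLin := by
    rw [injective_iff_map_eq_zero]
    intro c hc
    let p : Polynomial ℝ := ∑ j : Fin n, Polynomial.C (c j) * Polynomial.X ^ (j : ℕ)
    have hp : ∀ s, p.eval s = ∑ j : Fin n, s ^ (j : ℕ) * c j := fun s => by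
      simp only [p, Polynomial.eval_finsetSum, Polynomial.eval_mul, Polynomial.eval_C,
        Polynomial.eval_pow, Polynomial.eval_X, mul_comm (c _)]
    have hint : ∫ s in (0 : ℝ)..1, w s * (p.eval s) ^ 2 = 0 := by
      have h0 : ∑ i, c i * M.mulVec c i = 0 := by
        have : M.mulVec c = 0 := hc
        simp [this]
      refine Eq.trans ?_ h0
      simp only [hM, ← intervalIntegral.integral_const_mul]
      rw [← intervalIntegral.integral_finsetSum]
      · refine intervalIntegral.integral_congr fun s _ => ?_
        simp only [hp, sq]
        conv_lhs => rw [Finset.mul_sum, Finset.mul_sum]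
        exact Finset.sum_congr rfl fun j _ => by ring
      · intro j _
        exact Continuous.intervalIntegrable (by fun_prop) _ _
    have hzero : ∀ s ∈ Set.Ioo (0 : ℝ) 1, p.IsRoot s := by
      intro s hs
      by_contra hne
      have hne' : p.eval s ≠ 0 := hne
      have hlt : 0 < ∫ s in (0 : ℝ)..1, w s * (p.eval s) ^ 2 := by
        refine intervalIntegral.integral_pos zero_lt_one (by fun_prop) (fun x hx => ?_)
          ⟨s, Set.Ioo_subset_Icc_self hs, mul_pos (hpos s hs) (by positivity)⟩
        exact mul_nonneg (hnn x (Set.Ioc_subset_Icc_self hx)) (sq_nonneg _)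
      exact hlt.ne' hint
    have hp0 : p = 0 := Polynomial.eq_zero_of_infinite_isRoot p
      ((Set.Ioo_infinite zero_lt_one).mono hzero)
    ext j
    have := congrArg (fun P : Polynomial ℝ => P.coeff j) hp0
    simpa [p, Polynomial.finsetSum_coeff, Polynomial.coeff_X_pow, Fin.val_inj] using this
  have hsurj : Function.Surjective M.mulVecLin := LinearMap.injective_iff_surjective.1 hinj
  choose d hd using fun j : Fin n => hsurj (Pi.single j 1)
  refine ⟨fun j s => if h : j < n then ∑ i : Fin n, s ^ (i : ℕ) * d ⟨j, h⟩ i else 0, ?_, ?_⟩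
  · intro j
    by_cases h : j < n
    · refine ⟨fun i => if h' : i < n then d ⟨j, h⟩ ⟨i, h'⟩ else 0, fun s => ?_⟩
      simp [h, Finset.sum_range]
    · simpa [h] using IsPolyFun.zero
  · intro j hj i hi
    have h := congrFun (hd ⟨j, hj⟩) ⟨i, hi⟩
    rw [Matrix.mulVecLin_apply, hM] at h
    simp only [hj, dif_pos]
    rw [h]
    simp [Pi.single_apply]

lemma exists_bound_on_unit {r : ℕ → ℝ → ℝ} (hr : ∀ j, Continuous (r j)) :
    ∃ B : ℕ → ℝ, ∀ j, 0 ≤ B j ∧ ∀ s ∈ Set.Icc (0 : ℝ) 1, |r j s| ≤ B j := by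
  have h : ∀ j, ∃ B, ∀ s ∈ Set.Icc (0 : ℝ) 1, ‖r j s‖ ≤ B := fun j =>
    isCompact_Icc.exists_bound_of_continuousOn (hr j).continuousOn
  choose B hB using h
  exact ⟨B, fun j => ⟨(norm_nonneg _).trans (hB j 0 (by simp)), hB j⟩⟩

lemma integral_unit_affine {E : Type*} [NormedAddCommGroup E] [NormedSpace ℝ E] (f : ℝ → E)
    (a b : ℝ) : (b - a) • ∫ s in (0 : ℝ)..1, f (a + (b - a) * s) = ∫ t in a..b, f t := by
  rw [intervalIntegral.smul_integral_comp_add_mul]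
  simp

/-- Inverse inequality `L¹ → L^∞` for vector-valued polynomials. -/
lemma polyFun_inverse_inequality (n : ℕ) :
    ∃ C : ℝ, 1 ≤ C ∧ ∀ {E : Type} [NormedAddCommGroup E] [NormedSpace ℝ E] [CompleteSpace E]
      {G : ℝ → E}, IsPolyFun n G → ∀ {a b : ℝ}, a < b → ∀ t ∈ Set.Icc a b,
        (b - a) * ‖G t‖ ≤ C * ∫ s in a..b, ‖G s‖ := by
  obtain ⟨r, hrp, hr⟩ := exists_dual_polyFun (fun _ => 1) continuous_const (by simp) (by simp) n
  obtain ⟨B, hB⟩ := exists_bound_on_unit fun j => (hrp j).continuous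
  refine ⟨1 + ∑ j ∈ Finset.range n, B j, ?_, ?_⟩
  · have := Finset.sum_nonneg fun j (_ : j ∈ Finset.range n) => (hB j).1
    linarith
  intro E _ _ _ G hG a b hab t ht
  have hk : 0 < b - a := sub_pos.2 hab
  obtain ⟨c, hc⟩ := hG.comp_affine a (b - a)
  replace hc : ∀ s, G (a + (b - a) * s) = ∑ j ∈ Finset.range n, s ^ j • c j := hc
  have hcont : Continuous fun s => G (a + (b - a) * s) := hG.continuous.comp (by fun_prop)
  set I := ∫ s in (0 : ℝ)..1, ‖G (a + (b - a) * s)‖ with hI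
  have hI0 : 0 ≤ I := intervalIntegral.integral_nonneg zero_le_one fun _ _ => norm_nonneg _
  have hscale : (b - a) * I = ∫ s in a..b, ‖G s‖ := integral_unit_affine (fun t => ‖G t‖) a b
  have hcoef : ∀ j ∈ Finset.range n, ‖c j‖ ≤ B j * I := by
    intro j hj
    have hrep : ∫ s in (0 : ℝ)..1, r j s • G (a + (b - a) * s) = c j := by
      simp only [hc, Finset.smul_sum, smul_smul]
      rw [intervalIntegral.integral_finsetSum]
      · simp only [intervalIntegral.integral_smul_const]
        rw [Finset.sum_eq_single_of_mem j hj]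
        · have := hr j (Finset.mem_range.1 hj) j (Finset.mem_range.1 hj)
          simp only [one_mul, if_true] at this
          rw [this, one_smul]
        · intro i hi hij
          have := hr j (Finset.mem_range.1 hj) i (Finset.mem_range.1 hi)
          simp only [one_mul, hij, if_false] at this
          rw [this, zero_smul]
      · intro i _
        have := (hrp j).continuous
        exact Continuous.intervalIntegrable (by fun_prop) _ _
    rw [← hrep, hI, ← intervalIntegral.integral_const_mul]
    refine intervalIntegral.norm_integral_le_of_norm_le zero_le_one
      (Filter.Eventually.of_forall fun s hs => ?_)
      (Continuous.intervalIntegrable (continuous_const.mul hcont.norm) _ _)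
    rw [norm_smul]
    exact mul_le_mul_of_nonneg_right ((hB j).2 s (Set.Ioc_subset_Icc_self hs)) (norm_nonneg _)
  have ht' : G t = G (a + (b - a) * ((t - a) / (b - a))) := by
    congr 1
    field_simp
    ring
  have hs0 : 0 ≤ (t - a) / (b - a) := div_nonneg (sub_nonneg.2 ht.1) hk.le
  have hs1 : (t - a) / (b - a) ≤ 1 := by
    rw [div_le_one hk]
    linarith [ht.2]
  have hpt : ‖G t‖ ≤ (∑ j ∈ Finset.range n, B j) * I := by
    rw [ht', hc, Finset.sum_mul]
    refine norm_sum_le_of_le _ fun j hj => ?_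
    rw [norm_smul, norm_pow, Real.norm_of_nonneg hs0]
    calc _ ≤ 1 * ‖c j‖ := mul_le_mul_of_nonneg_right (pow_le_one₀ hs0 hs1) (norm_nonneg _)
      _ ≤ B j * I := by simpa using hcoef j hj
  calc (b - a) * ‖G t‖ ≤ (b - a) * ((1 + ∑ j ∈ Finset.range n, B j) * I) := by
        gcongr
        nlinarith
    _ = _ := by rw [← hscale]; ring

/-- The discontinuous Galerkin projection: it interpolates at the right end point and matches the
moments against polynomials of degree less than `q`. -/
lemma exists_dG_projection (q : ℕ) :
    ∃ C : ℝ, 0 ≤ C ∧ ∀ {E : Type} [NormedAddCommGroup E] [NormedSpace ℝ E] [CompleteSpace E]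
      {R : ℝ → E} {a b : ℝ}, a < b → ContinuousOn R (Set.Icc a b) →
      ∃ w : ℝ → E, IsPolyFun (q + 1) w ∧ w b = R b ∧
        (∀ p : ℝ → ℝ, IsPolyFun q p → ∫ s in a..b, p s • (w s - R s) = 0) ∧
        ∀ (L : E →L[ℝ] E) (M : ℝ), (∀ t ∈ Set.Icc a b, ‖L (R t)‖ ≤ M) →
          ∀ t ∈ Set.Icc a b, ‖L (w t)‖ ≤ C * M := by
  obtain ⟨r, hrp, hr⟩ := exists_dual_polyFun (fun s => 1 - s) (by fun_prop)
    (fun s hs => sub_pos.2 hs.2) (fun s hs => sub_nonneg.2 hs.2) q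
  obtain ⟨B, hB⟩ := exists_bound_on_unit fun j => (hrp j).continuous
  have hBs := Finset.sum_nonneg fun j (_ : j ∈ Finset.range q) => (hB j).1
  refine ⟨1 + 2 * ∑ j ∈ Finset.range q, B j, by positivity, ?_⟩
  intro E _ _ _ R a b hab hR
  have hk : 0 < b - a := sub_pos.2 hab
  have hmaps : ∀ s ∈ Set.Icc (0 : ℝ) 1, a + (b - a) * s ∈ Set.Icc a b := fun s hs =>
    ⟨by nlinarith [hs.1], by nlinarith [hs.2]⟩
  let Q : ℝ → E := fun s => R (a + (b - a) * s)
  have hQ : ContinuousOn Q (Set.Icc 0 1) := hR.comp (by fun_prop) hmaps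
  have hQ1 : Q 1 = R b := by simp [Q]
  let m : ℕ → E := fun j => ∫ s in (0 : ℝ)..1, s ^ j • (Q 1 - Q s)
  let v : ℝ → E := fun s => Q 1 + (s - 1) • ∑ j ∈ Finset.range q, r j s • m j
  have hsum : IsPolyFun q (fun s => ∑ j ∈ Finset.range q, r j s • m j) :=
    IsPolyFun.sum _ fun j _ => (hrp j).smul_const _
  have hv : IsPolyFun (q + 1) v := by
    convert (IsPolyFun.const (Q 1)).add (hsum.id_smul.sub (hsum.mono (Nat.le_succ q)))
      using 2 with s
    simp [v, sub_smul]
  have hint : ∀ p : ℝ → ℝ, Continuous p →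
      IntervalIntegrable (fun s => p s • (Q 1 - Q s)) volume 0 1 := fun p hp =>
    ContinuousOn.intervalIntegrable
      (by rw [Set.uIcc_of_le zero_le_one]; exact hp.continuousOn.smul (continuousOn_const.sub hQ))
  have hmom : ∀ i < q, ∫ s in (0 : ℝ)..1, s ^ i • (v s - Q s) = 0 := by
    intro i hi
    have hsplit : ∀ s : ℝ, s ^ i • (v s - Q s) = s ^ i • (Q 1 - Q s)
        - ∑ j ∈ Finset.range q, ((1 - s) * (r j s * s ^ i)) • m j := by
      intro s
      have : ∀ j, ((1 - s) * (r j s * s ^ i)) • m j = (s ^ i * (1 - s)) • (r j s • m j) := by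
        intro j
        rw [smul_smul]
        congr 1
        ring
      simp only [this, ← Finset.smul_sum, v]
      module
    have hcts : ∀ j, IntervalIntegrable (fun s : ℝ => ((1 - s) * (r j s * s ^ i)) • m j)
        volume 0 1 := by
      intro j
      have := (hrp j).continuous
      exact Continuous.intervalIntegrable (by fun_prop) _ _
    simp only [hsplit]
    rw [intervalIntegral.integral_sub (hint _ (by fun_prop))
      (by
        have := fun j => (hrp j).continuous
        exact Continuous.intervalIntegrable (by fun_prop) _ _),
      intervalIntegral.integral_finsetSum fun j _ => hcts j]
    simp only [intervalIntegral.integral_smul_const]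
    rw [Finset.sum_eq_single_of_mem i (Finset.mem_range.2 hi), hr i hi i hi]
    · simp [m]
    · intro j hj hji
      rw [hr j (Finset.mem_range.1 hj) i hi, if_neg hji.symm, zero_smul]
  have hw_eq : ∀ s, v (-a / (b - a) + (b - a)⁻¹ * (a + (b - a) * s)) = v s := by
    intro s
    congr 1
    field_simp
    ring
  refine ⟨fun t => v (-a / (b - a) + (b - a)⁻¹ * t), hv.comp_affine _ _, ?_, ?_, ?_⟩
  · have : -a / (b - a) + (b - a)⁻¹ * b = 1 := by
      field_simp
      ring
    simp [this, v, hQ1]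
  · intro p hp
    obtain ⟨d, hd⟩ := hp.comp_affine a (b - a)
    rw [← integral_unit_affine]
    simp only [hw_eq, hd]
    have : ∀ s, (∑ j ∈ Finset.range q, s ^ j • d j) • (v s - R (a + (b - a) * s))
        = ∑ j ∈ Finset.range q, d j • (s ^ j • (v s - Q s)) := by
      intro s
      simp only [Finset.sum_smul, smul_smul, smul_eq_mul, mul_comm, Q]
    simp only [this]
    rw [intervalIntegral.integral_finsetSum]
    · simp only [intervalIntegral.integral_smul]
      rw [Finset.sum_eq_zero, smul_zero]
      intro j hj
      rw [hmom j (Finset.mem_range.1 hj), smul_zero]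
    · intro j _
      refine ContinuousOn.intervalIntegrable ?_
      rw [Set.uIcc_of_le zero_le_one]
      have := hv.continuous
      exact continuousOn_const.smul ((by fun_prop : Continuous fun s : ℝ => s ^ j).continuousOn.smul
        (this.continuousOn.sub hQ))
  · intro L M hM t ht
    set s := -a / (b - a) + (b - a)⁻¹ * t with hs
    have hs' : s = (t - a) / (b - a) := by
      rw [hs]
      field_simp
      ring
    have hs0 : 0 ≤ s := by
      rw [hs']
      exact div_nonneg (sub_nonneg.2 ht.1) hk.le
    have hs1 : s ≤ 1 := by
      rw [hs', div_le_one hk]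
      linarith [ht.2]
    have hM0 : 0 ≤ M := (norm_nonneg _).trans (hM t ht)
    have hQM : ∀ x ∈ Set.Icc (0 : ℝ) 1, ‖L (Q x)‖ ≤ M := fun x hx => hM _ (hmaps x hx)
    have hLm : ∀ j, ‖L (m j)‖ ≤ 2 * M := by
      intro j
      rw [← L.intervalIntegral_comp_comm (hint _ (by fun_prop))]
      have := intervalIntegral.norm_integral_le_of_norm_le_const (a := (0 : ℝ)) (b := 1) (C := 2 * M)
        (f := fun s : ℝ => L (s ^ j • (Q 1 - Q s))) ?_
      · simpa using this
      · intro x hx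
        rw [Set.uIoc_of_le zero_le_one] at hx
        rw [map_smul, norm_smul, norm_pow, Real.norm_of_nonneg hx.1.le, map_sub]
        calc x ^ j * ‖L (Q 1) - L (Q x)‖ ≤ 1 * (‖L (Q 1)‖ + ‖L (Q x)‖) :=
              mul_le_mul (pow_le_one₀ hx.1.le hx.2) (norm_sub_le _ _) (norm_nonneg _) zero_le_one
          _ ≤ 2 * M := by
              linarith [hQM 1 (by simp), hQM x (Set.Ioc_subset_Icc_self hx)]
    have hLsum : ‖∑ j ∈ Finset.range q, r j s • L (m j)‖ ≤ (∑ j ∈ Finset.range q, B j) * (2 * M) := by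
      rw [Finset.sum_mul]
      refine norm_sum_le_of_le _ fun j _ => ?_
      rw [norm_smul]
      exact mul_le_mul ((hB j).2 s ⟨hs0, hs1⟩) (hLm j) (norm_nonneg _) (hB j).1
    have hval : L (v s) = L (Q 1) + (s - 1) • ∑ j ∈ Finset.range q, r j s • L (m j) := by
      simp [v]
    rw [hval]
    refine (norm_add_le _ _).trans ?_
    rw [norm_smul]
    have h1 : ‖s - 1‖ ≤ 1 := by
      rw [Real.norm_eq_abs, abs_le]
      constructor <;> linarith
    have := mul_le_mul h1 hLsum (norm_nonneg _) zero_le_one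
    linarith [hQM 1 (by simp)]

/-- Taylor-type approximation on an open interval, measured through a continuous linear map. -/
lemma exists_polyFun_taylor {E : Type*} [NormedAddCommGroup E] [NormedSpace ℝ E] [CompleteSpace E]
    (L : E →L[ℝ] E) {a b : ℝ} (hab : a < b) {β : ℝ → ℝ} (hβ : IntervalIntegrable β volume a b)
    (q : ℕ) (g : ℕ → ℝ → E)
    (hg : ∀ m < q + 1, ∀ t ∈ Set.Ioo a b, HasDerivAt (g m) (g (m + 1) t) t)
    (hb : ∀ t ∈ Set.Ioo a b, ‖L (g (q + 1) t)‖ ≤ β t) :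
    ∃ w : ℝ → E, IsPolyFun (q + 1) w ∧
      ∀ t ∈ Set.Ioo a b, ‖L (g 0 t - w t)‖ ≤ (b - a) ^ q * ∫ s in a..b, β s := by
  have hc : (a + b) / 2 ∈ Set.Ioo a b := ⟨by linarith, by linarith⟩
  set c := (a + b) / 2
  induction q generalizing g with
  | zero =>
    refine ⟨fun _ => g 0 c, IsPolyFun.const _, fun t ht => ?_⟩
    have hsub : Set.uIcc c t ⊆ Set.Ioo a b := Set.ordConnected_Ioo.uIcc_subset hc ht
    have hsub' : Set.uIoc c t ⊆ Set.Ioo a b := Set.uIoc_subset_uIcc.trans hsub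
    have hsub'' : Set.uIoc c t ⊆ Set.uIoc a b := by
      rw [Set.uIoc_of_le hab.le]
      exact hsub'.trans Set.Ioo_subset_Ioc_self
    have hd : ∀ s ∈ Set.Ioo a b, HasDerivAt (fun s => L (g 0 s)) (L (g 1 s)) s := fun s hs =>
      L.hasFDerivAt.comp_hasDerivAt s (hg 0 zero_lt_one s hs)
    have hβ' : IntervalIntegrable β volume c t := by
      rw [intervalIntegrable_iff] at hβ ⊢
      exact hβ.mono_set hsub''
    have hle : ∀ᵐ s ∂volume.restrict (Set.uIoc c t), ‖L (g 1 s)‖ ≤ β s :=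
      (ae_restrict_iff' measurableSet_uIoc).2
        (Filter.Eventually.of_forall fun s hs => hb s (hsub' hs))
    have hint : IntervalIntegrable (fun s => L (g 1 s)) volume c t := by
      rw [intervalIntegrable_iff] at hβ' ⊢
      refine Integrable.mono' hβ' ?_ hle
      refine (stronglyMeasurable_deriv fun s => L (g 0 s)).aestronglyMeasurable.congr ?_
      exact (ae_restrict_iff' measurableSet_uIoc).2
        (Filter.Eventually.of_forall fun s hs => (hd s (hsub' hs)).deriv)
    have hβ0 : 0 ≤ᵐ[volume.restrict (Set.uIoc a b)] β := by
      rw [Set.uIoc_of_le hab.le, ← Measure.restrict_congr_set Ioo_ae_eq_Ioc]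
      exact (ae_restrict_iff' measurableSet_Ioo).2
        (Filter.Eventually.of_forall fun s hs => (norm_nonneg _).trans (hb s hs))
    rw [map_sub, ← intervalIntegral.integral_eq_sub_of_hasDerivAt (fun s hs => hd s (hsub hs)) hint]
    calc _ ≤ |∫ s in c..t, β s| := intervalIntegral.norm_integral_le_abs_of_norm_le hle hβ'
      _ ≤ |∫ s in a..b, β s| := intervalIntegral.abs_integral_mono_interval hsub'' hβ0 hβ
      _ = _ := by
        rw [abs_of_nonneg, pow_zero, one_mul]
        refine intervalIntegral.integral_nonneg_of_ae_restrict hab.le ?_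
        rw [Set.uIoc_of_le hab.le] at hβ0
        rwa [← Measure.restrict_congr_set Ioc_ae_eq_Icc]
  | succ q ih =>
    obtain ⟨v, hv, hvb⟩ := ih (fun m => g (m + 1)) (fun m hm => hg (m + 1) (by omega)) hb
    obtain ⟨V, hV, hVd⟩ := hv.exists_primitive
    refine ⟨fun t => V t + (g 0 c - V c), hV.add (IsPolyFun.const _), fun t ht => ?_⟩
    have hd : ∀ s ∈ Set.Ioo a b, HasDerivWithinAt (fun s => L (g 0 s - V s))
        (L (g 1 s - v s)) (Set.Ioo a b) s := fun s hs =>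
      (L.hasFDerivAt.comp_hasDerivAt s ((hg 0 (by omega) s hs).sub (hVd s))).hasDerivWithinAt
    have h := (convex_Ioo a b).norm_image_sub_le_of_norm_hasDerivWithin_le hd hvb hc ht
    have heq : L (g 0 t - (V t + (g 0 c - V c))) = L (g 0 t - V t) - L (g 0 c - V c) := by
      rw [← map_sub]
      congr 1
      abel
    rw [heq]
    refine h.trans ?_
    have hM : 0 ≤ (b - a) ^ q * ∫ s in a..b, β s := (norm_nonneg _).trans (hvb c hc)
    have htc : ‖t - c‖ ≤ b - a := by
      rw [Real.norm_eq_abs, abs_le]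
      constructor <;> linarith [ht.1, ht.2, hc.1, hc.2]
    calc _ ≤ ((b - a) ^ q * ∫ s in a..b, β s) * (b - a) := mul_le_mul_of_nonneg_left htc hM
      _ = _ := by ring

/-- Optimal order of the discontinuous Galerkin projection. -/
lemma exists_dG_projection_error (q : ℕ) :
    ∃ C : ℝ, 0 ≤ C ∧ ∀ {E : Type} [NormedAddCommGroup E] [NormedSpace ℝ E] [CompleteSpace E]
      (L : E →L[ℝ] E) {a b : ℝ}, a < b → ∀ {β : ℝ → ℝ}, IntervalIntegrable β volume a b →
      ∀ g : ℕ → ℝ → E, ContinuousOn (g 0) (Set.Icc a b) →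
      (∀ m < q + 1, ∀ t ∈ Set.Ioo a b, HasDerivAt (g m) (g (m + 1) t) t) →
      (∀ t ∈ Set.Ioo a b, ‖L (g (q + 1) t)‖ ≤ β t) →
      ∃ w : ℝ → E, IsPolyFun (q + 1) w ∧ w b = g 0 b ∧
        (∀ p : ℝ → ℝ, IsPolyFun q p → ∫ s in a..b, p s • (w s - g 0 s) = 0) ∧
        ∫ s in a..b, ‖L (g 0 s - w s)‖ ≤ C * ((b - a) ^ (q + 1) * ∫ s in a..b, β s) := by
  obtain ⟨C, hC, hproj⟩ := exists_dG_projection q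
  refine ⟨1 + C, by positivity, ?_⟩
  intro E _ _ _ L a b hab β hβ g hcont hg hb
  obtain ⟨v, hv, hvb⟩ := exists_polyFun_taylor L hab hβ q g hg hb
  set M := (b - a) ^ q * ∫ s in a..b, β s with hM
  have hR : ContinuousOn (fun t => g 0 t - v t) (Set.Icc a b) :=
    hcont.sub hv.continuous.continuousOn
  have hLR : ∀ t ∈ Set.Icc a b, ‖L (g 0 t - v t)‖ ≤ M := by
    intro t ht
    rw [← closure_Ioo hab.ne] at ht
    refine le_on_closure hvb ?_ continuousOn_const ht
    rw [closure_Ioo hab.ne]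
    exact (L.continuous.comp_continuousOn hR).norm
  obtain ⟨w, hw, hwb, hwo, hwL⟩ := hproj hab hR
  refine ⟨fun t => v t + w t, hv.add hw, by simp [hwb], fun p hp => ?_, ?_⟩
  · rw [← hwo p hp]
    refine intervalIntegral.integral_congr fun s _ => ?_
    simp only
    congr 1
    abel
  · have hpt : ∀ t ∈ Set.uIoc a b, ‖‖L (g 0 t - (v t + w t))‖‖ ≤ (1 + C) * M := by
      intro t ht
      rw [Set.uIoc_of_le hab.le] at ht
      have ht' := Set.Ioc_subset_Icc_self ht
      rw [norm_norm, ← sub_sub, map_sub]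
      refine (norm_sub_le _ _).trans ?_
      linarith [hLR t ht', hwL L M hLR t ht']
    have h := intervalIntegral.norm_integral_le_of_norm_le_const hpt
    rw [abs_of_pos (sub_pos.2 hab)] at h
    refine (le_abs_self _).trans (h.trans_eq ?_)
    rw [hM]
    ring

lemma integral_inner_polyFun {E : Type*} [NormedAddCommGroup E] [InnerProductSpace ℝ E]
    [CompleteSpace E] {n : ℕ} (c : ℕ → E) {h : ℝ → E} {a b : ℝ} (hab : a ≤ b)
    (hh : ContinuousOn h (Set.Icc a b)) :
    ∫ s in a..b, ⟪∑ j ∈ Finset.range n, s ^ j • c j, h s⟫ =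
      ∑ j ∈ Finset.range n, ⟪c j, ∫ s in a..b, s ^ j • h s⟫ := by
  have hint : ∀ j : ℕ, IntervalIntegrable (fun s => s ^ j • h s) volume a b := fun j =>
    ContinuousOn.intervalIntegrable (by
      rw [Set.uIcc_of_le hab]
      exact (continuous_pow j).continuousOn.smul hh)
  have hcomm : ∀ j : ℕ, ⟪c j, ∫ s in a..b, s ^ j • h s⟫ = ∫ s in a..b, ⟪c j, s ^ j • h s⟫ :=
    fun j => ((innerSL ℝ (c j)).intervalIntegral_comp_comm (hint j)).symm
  simp only [hcomm]
  rw [← intervalIntegral.integral_finsetSum]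
  · simp only [sum_inner, inner_smul_left, inner_smul_right]
    simp
  · intro j _
    refine ContinuousOn.intervalIntegrable ?_
    rw [Set.uIcc_of_le hab]
    exact continuousOn_const.inner ((continuous_pow j).continuousOn.smul hh)

/-- One-step nodal stability of the dG method for a skew-symmetric evolution equation. -/
lemma dG_step_stability (q : ℕ) :
    ∃ K : ℝ, 0 ≤ K ∧ ∀ {E : Type} [NormedAddCommGroup E] [InnerProductSpace ℝ E] [CompleteSpace E]
      (J : E →L[ℝ] E), (∀ v, ⟪J v, v⟫ = 0) → ∀ {a b : ℝ}, a < b → ∀ {θ θ' r : ℝ → E},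
      IsPolyFun (q + 1) θ → (∀ s, HasDerivAt θ (θ' s) s) → ContinuousOn r (Set.Icc a b) →
      ∀ {θm : E},
      (∀ p : ℝ → ℝ, IsPolyFun (q + 1) p →
        (∫ s in a..b, p s • (θ' s + J (θ s))) + p a • (θ a - θm) = ∫ s in a..b, p s • r s) →
      ‖θ b‖ ≤ ‖θm‖ + K * ∫ s in a..b, ‖r s‖ := by
  obtain ⟨C, hC, hinv⟩ := polyFun_inverse_inequality (q + 1)
  refine ⟨10 * C, by positivity, ?_⟩
  intro E _ _ _ J hJ a b hab θ θ' r hθ hθd hr θm heq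
  have hk : 0 < b - a := sub_pos.2 hab
  have hθ' : IsPolyFun (q + 1) θ' := by
    obtain ⟨f', hf', hd⟩ := hθ.exists_deriv
    have : θ' = f' := funext fun s => (hθd s).unique (hd s)
    rw [this]
    exact hf'.mono (Nat.le_succ q)
  set G : ℝ → E := fun s => θ' s + J (θ s) with hGdef
  have hG : IsPolyFun (q + 1) G := hθ'.add (hθ.map J)
  have hGc := hG.continuous
  have hθc := hθ.continuous
  have hθ'c := hθ'.continuous
  set j := θ a - θm with hj
  set ε := ∫ s in a..b, ‖r s‖ with hε
  have hε0 : 0 ≤ ε := intervalIntegral.integral_nonneg hab.le fun _ _ => norm_nonneg _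
  have htest : ∀ P : ℝ → E, IsPolyFun (q + 1) P →
      (∫ s in a..b, ⟪P s, G s⟫) + ⟪P a, j⟫ = ∫ s in a..b, ⟪P s, r s⟫ := by
    rintro P ⟨c, hc⟩
    simp only [hc]
    rw [integral_inner_polyFun c hab.le hGc.continuousOn, integral_inner_polyFun c hab.le hr,
      sum_inner, ← Finset.sum_add_distrib]
    refine Finset.sum_congr rfl fun i hi => ?_
    have hmon : IsPolyFun (q + 1) (fun s : ℝ => s ^ i) := by
      have := (IsPolyFun.affine_pow 0 1 i).mono (Nat.succ_le_of_lt (Finset.mem_range.1 hi))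
      simpa using this
    rw [← heq _ hmon, inner_add_right, inner_smul_left, inner_smul_right]
    simp only [hGdef, conj_trivial]
  have hrint : ∀ P : ℝ → E, Continuous P → ∀ S, (∀ t ∈ Set.Icc a b, ‖P t‖ ≤ S) →
      |∫ s in a..b, ⟪P s, r s⟫| ≤ S * ε := by
    intro P hP S hS
    rw [hε, ← intervalIntegral.integral_const_mul, ← Real.norm_eq_abs]
    refine intervalIntegral.norm_integral_le_of_norm_le hab.le
      (Filter.Eventually.of_forall fun s hs => ?_) (ContinuousOn.intervalIntegrable ?_)
    · exact (norm_inner_le_norm _ _).trans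
        (mul_le_mul_of_nonneg_right (hS s (Set.Ioc_subset_Icc_self hs)) (norm_nonneg _))
    · rw [Set.uIcc_of_le hab.le]
      exact continuousOn_const.mul hr.norm
  have henergy : ∀ t, ∫ s in a..t, ⟪θ s, G s⟫ = (‖θ t‖ ^ 2 - ‖θ a‖ ^ 2) / 2 := by
    intro t
    have hd : ∀ s ∈ Set.uIcc a t, HasDerivAt (fun s => ‖θ s‖ ^ 2 / 2) ⟪θ s, G s⟫ s := by
      intro s _
      have h := ((hθd s).norm_sq).div_const 2
      have hskew : ⟪θ s, G s⟫ = ⟪θ s, θ' s⟫ := by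
        rw [hGdef, inner_add_right, real_inner_comm (J (θ s)), hJ, add_zero]
      rw [hskew]
      simpa using h
    rw [intervalIntegral.integral_eq_sub_of_hasDerivAt hd
      (Continuous.intervalIntegrable (by fun_prop) _ _)]
    ring
  obtain ⟨tmax, htmax, hmax⟩ := isCompact_Icc.exists_isMaxOn (Set.nonempty_Icc.2 hab.le)
    hθc.norm.continuousOn
  have hmax' : ∀ t ∈ Set.Icc a b, ‖θ t‖ ≤ ‖θ tmax‖ := fun t ht => hmax ht
  set S := ‖θ tmax‖ with hS
  have hS0 : 0 ≤ S := norm_nonneg _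
  set D := ∫ s in a..b, ‖G s‖ with hD
  have hD0 : 0 ≤ D := intervalIntegral.integral_nonneg hab.le fun _ _ => norm_nonneg _
  have hnode : ‖θ b‖ ^ 2 + ‖j‖ ^ 2 ≤ ‖θm‖ ^ 2 + 2 * (S * ε) := by
    have h1 := htest θ hθ
    rw [henergy] at h1
    have h2 := (abs_le.1 (hrint θ hθc S hmax')).2
    have h3 : ‖θm‖ ^ 2 = ‖θ a‖ ^ 2 - 2 * ⟪θ a, j⟫ + ‖j‖ ^ 2 := by
      rw [← norm_sub_sq_real]
      simp [hj]
    linarith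
  have hDle : D ≤ C * (‖j‖ + ε) := by
    have hsup : ∀ t ∈ Set.Icc a b, ‖G t‖ ≤ C * D / (b - a) := fun t ht => by
      rw [le_div_iff₀ hk, mul_comm]
      exact hinv hG hab t ht
    have h1 := htest G hG
    have h2 := (abs_le.1 (hrint G hGc _ hsup)).2
    have h3 : -⟪G a, j⟫ ≤ C * D / (b - a) * ‖j‖ :=
      (neg_le_abs _).trans ((abs_real_inner_le_norm _ _).trans
        (mul_le_mul_of_nonneg_right (hsup a (Set.left_mem_Icc.2 hab.le)) (norm_nonneg _)))
    have h4 : 0 ≤ ∫ s in a..b, (‖G s‖ - D / (b - a)) ^ 2 :=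
      intervalIntegral.integral_nonneg hab.le fun _ _ => sq_nonneg _
    have h5 : ∫ s in a..b, (‖G s‖ - D / (b - a)) ^ 2 =
        (∫ s in a..b, ⟪G s, G s⟫) - D ^ 2 / (b - a) := by
      have hpt : ∀ s, (‖G s‖ - D / (b - a)) ^ 2 =
          ⟪G s, G s⟫ - 2 * (D / (b - a)) * ‖G s‖ + (D / (b - a)) ^ 2 := fun s => by
        rw [real_inner_self_eq_norm_sq]
        ring
      simp only [hpt]
      rw [intervalIntegral.integral_add (Continuous.intervalIntegrable (by fun_prop) _ _)
        (Continuous.intervalIntegrable (by fun_prop) _ _),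
        intervalIntegral.integral_sub (Continuous.intervalIntegrable (by fun_prop) _ _)
        (Continuous.intervalIntegrable (by fun_prop) _ _),
        intervalIntegral.integral_const_mul, intervalIntegral.integral_const, ← hD, smul_eq_mul]
      field_simp
      ring
    have h6 : D ^ 2 / (b - a) ≤ C * D / (b - a) * (‖j‖ + ε) := by linarith
    have h7 : D * D ≤ D * (C * (‖j‖ + ε)) := by
      rw [div_le_iff₀ hk] at h6
      have : C * D / (b - a) * (‖j‖ + ε) * (b - a) = D * (C * (‖j‖ + ε)) := by
        field_simp
      nlinarith
    rcases hD0.eq_or_lt with h0 | h0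
    · rw [← h0]
      positivity
    · exact le_of_mul_le_mul_left h7 h0
  have hSle : S ≤ ‖θ a‖ + 2 * D := by
    have h1 : |∫ s in a..tmax, ⟪θ s, G s⟫| ≤ S * D := by
      have hsub : Set.uIoc a tmax ⊆ Set.uIoc a b := by
        rw [Set.uIoc_of_le hab.le, Set.uIoc_of_le htmax.1]
        exact Set.Ioc_subset_Ioc_right htmax.2
      calc |∫ s in a..tmax, ⟪θ s, G s⟫| ≤ ∫ s in a..tmax, S * ‖G s‖ := by
            rw [← Real.norm_eq_abs]
            refine intervalIntegral.norm_integral_le_of_norm_le htmax.1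
              (Filter.Eventually.of_forall fun s hs => ?_)
              (Continuous.intervalIntegrable (by fun_prop) _ _)
            exact (norm_inner_le_norm _ _).trans (mul_le_mul_of_nonneg_right
              (hmax' s ⟨hs.1.le, hs.2.trans htmax.2⟩) (norm_nonneg _))
        _ = S * ∫ s in a..tmax, ‖G s‖ := intervalIntegral.integral_const_mul _ _
        _ ≤ S * D := by
            refine mul_le_mul_of_nonneg_left ?_ hS0
            refine intervalIntegral.integral_mono_interval le_rfl htmax.1 htmax.2
              (Filter.Eventually.of_forall fun _ => norm_nonneg _)
              (Continuous.intervalIntegrable (by fun_prop) _ _)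
    rw [henergy] at h1
    have h2 := (abs_le.1 h1).2
    have h3 := hmax' a (Set.left_mem_Icc.2 hab.le)
    have h4 : S * S ≤ S * (‖θ a‖ + 2 * D) := by
      nlinarith [norm_nonneg (θ a)]
    rcases hS0.eq_or_lt with h0 | h0
    · rw [← h0]
      positivity
    · exact le_of_mul_le_mul_left h4 h0
  have hθa : ‖θ a‖ ≤ ‖θm‖ + ‖j‖ := by
    have : θ a = θm + j := by simp [hj]
    rw [this]
    exact norm_add_le _ _
  have hA0 := norm_nonneg θm
  have hj0 := norm_nonneg j
  have hjle : ‖j‖ ≤ ‖θm‖ + S / (6 * C) + 6 * C * ε := by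
    have hx : 0 ≤ S / (6 * C) := by positivity
    have hxC : S / (6 * C) * (6 * C * ε) = S * ε := by field_simp
    refine le_of_sq_le_sq ?_ (by positivity)
    nlinarith [sq_nonneg ‖θ b‖, mul_nonneg hA0 hx,
      mul_nonneg hA0 (by positivity : 0 ≤ 6 * C * ε), sq_nonneg (S / (6 * C)),
      sq_nonneg (6 * C * ε)]
  have hSfin : S ≤ 2 * ((1 + 3 * C) * ‖θm‖ + (18 * C ^ 2 + 2 * C) * ε) := by
    have h1 : S ≤ ‖θm‖ + 3 * C * ‖j‖ + 2 * C * ε := by nlinarith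
    have h2 : 3 * C * ‖j‖ ≤ 3 * C * (‖θm‖ + S / (6 * C) + 6 * C * ε) :=
      mul_le_mul_of_nonneg_left hjle (by positivity)
    have h3 : 3 * C * (‖θm‖ + S / (6 * C) + 6 * C * ε) =
        3 * C * ‖θm‖ + S / 2 + 18 * C ^ 2 * ε := by
      field_simp
      ring
    linarith
  refine le_of_sq_le_sq ?_ (by positivity)
  have h1 : S * ε ≤ 2 * ((1 + 3 * C) * ‖θm‖ + (18 * C ^ 2 + 2 * C) * ε) * ε :=
    mul_le_mul_of_nonneg_right hSfin hε0
  have h2 : 0 ≤ (C - 1) * (‖θm‖ * ε) := mul_nonneg (sub_nonneg.2 hC) (by positivity)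
  have h3 : 0 ≤ (C - 1) * (C * ε ^ 2) := mul_nonneg (sub_nonneg.2 hC) (by positivity)
  have h4 : 0 ≤ C * (‖θm‖ * ε) := by positivity
  have h5 : 0 ≤ C ^ 2 * ε ^ 2 := by positivity
  nlinarith [sq_nonneg ‖j‖]

/-- One-step nodal error of the dG method for `dζ/dt + J ζ = F` with `J` skew-symmetric. -/
lemma dG_step_error (q : ℕ) :
    ∃ K : ℝ, 0 < K ∧ ∀ {E : Type} [NormedAddCommGroup E] [InnerProductSpace ℝ E] [CompleteSpace E]
      (J : E →L[ℝ] E), (∀ v, ⟪J v, v⟫ = 0) → ∀ {a b : ℝ}, a < b →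
      ∀ {β : ℝ → ℝ}, IntervalIntegrable β volume a b →
      ∀ g : ℕ → ℝ → E, ContinuousOn (g 0) (Set.Icc a b) →
      (∀ m < q + 1, ∀ t ∈ Set.Ioo a b, HasDerivAt (g m) (g (m + 1) t) t) →
      (∀ t ∈ Set.Ioo a b, ‖J (g (q + 1) t)‖ ≤ β t) →
      ∀ {F : ℝ → E}, IntervalIntegrable F volume a b →
      (∀ t ∈ Set.Ioo a b, HasDerivAt (g 0) (F t - J (g 0 t)) t) →
      ∀ {U U' : ℝ → E} {Um : E}, IsPolyFun (q + 1) U → (∀ s, HasDerivAt U (U' s) s) →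
      (∀ p : ℝ → ℝ, IsPolyFun (q + 1) p →
        (∫ s in a..b, p s • (U' s + J (U s))) + p a • (U a - Um) = ∫ s in a..b, p s • F s) →
      ‖U b - g 0 b‖ ≤ ‖Um - g 0 a‖ + K * ((b - a) ^ (q + 1) * ∫ s in a..b, β s) := by
  obtain ⟨C, hC, hproj⟩ := exists_dG_projection_error q
  obtain ⟨K, hK, hstab⟩ := dG_step_stability q
  refine ⟨K * C + 1, by positivity, ?_⟩
  intro E _ _ _ J hJ a b hab β hβ g hg0 hg hb F hF hode U U' Um hU hU' heq
  obtain ⟨w, hw, hwb, hwo, hwe⟩ := hproj J hab hβ g hg0 hg hb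
  obtain ⟨w', hw', hwd⟩ := hw.exists_deriv
  have hU'c : Continuous U' := by
    obtain ⟨f', hf', hd⟩ := hU.exists_deriv
    rw [show U' = f' from funext fun s => (hU' s).unique (hd s)]
    exact hf'.continuous
  have hUc := hU.continuous
  have hwc := hw.continuous
  have hw'c := hw'.continuous
  have hβ0 : 0 ≤ ∫ s in a..b, β s := by
    refine intervalIntegral.integral_nonneg_of_ae_restrict hab.le ?_
    rw [← Measure.restrict_congr_set Ioo_ae_eq_Icc]
    exact (ae_restrict_iff' measurableSet_Ioo).2
      (Filter.Eventually.of_forall fun s hs => (norm_nonneg _).trans (hb s hs))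
  have hr : ContinuousOn (fun s => J (g 0 s - w s)) (Set.Icc a b) :=
    J.continuous.comp_continuousOn (hg0.sub hwc.continuousOn)
  have hmain := hstab J hJ hab (hU.sub hw) (fun s => (hU' s).sub (hwd s)) hr
    (θm := Um - g 0 a) ?_
  · rw [hwb] at hmain
    have h1 := mul_le_mul_of_nonneg_left hwe hK
    have h2 : 0 ≤ (b - a) ^ (q + 1) * ∫ s in a..b, β s :=
      mul_nonneg (pow_nonneg (sub_pos.2 hab).le _) hβ0
    linarith
  · intro p hp
    obtain ⟨p', hp', hpd⟩ := hp.exists_deriv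
    have hpc := hp.continuous
    have hp'c := hp'.continuous
    have hg0i : IntervalIntegrable (g 0) volume a b :=
      ContinuousOn.intervalIntegrable (by rwa [Set.uIcc_of_le hab.le])
    have hJg : IntervalIntegrable (fun s => J (g 0 s)) volume a b :=
      ContinuousOn.intervalIntegrable
        (by rw [Set.uIcc_of_le hab.le]; exact J.continuous.comp_continuousOn hg0)
    have hsm : ∀ {r : ℝ → ℝ} {h : ℝ → E}, Continuous r → IntervalIntegrable h volume a b →
        IntervalIntegrable (fun s => r s • h s) volume a b := fun hr hh =>
      hh.continuousOn_smul hr.continuousOn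
    have hci : ∀ {h : ℝ → E}, Continuous h → IntervalIntegrable h volume a b := fun hh =>
      hh.intervalIntegrable _ _
    have hζ' : IntervalIntegrable (fun s => F s - J (g 0 s)) volume a b := hF.sub hJg
    have hparts : ∫ s in a..b, (p s • (w' s - (F s - J (g 0 s))) + p' s • (w s - g 0 s)) =
        p b • (w b - g 0 b) - p a • (w a - g 0 a) := by
      refine intervalIntegral.integral_eq_sub_of_hasDerivAt_of_le hab.le
        (f := fun s => p s • (w s - g 0 s))
        (hpc.continuousOn.smul (hwc.continuousOn.sub hg0))
        (fun s hs => (hpd s).smul ((hwd s).sub (hode s hs))) ?_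
      exact (hsm hpc ((hci hw'c).sub hζ')).add (hsm hp'c ((hci hwc).sub hg0i))
    rw [intervalIntegral.integral_add (hsm hpc ((hci hw'c).sub hζ'))
      (hsm hp'c ((hci hwc).sub hg0i)), hwo p' hp', hwb, sub_self, smul_zero, zero_sub,
      add_zero] at hparts
    have hUeq := heq p hp
    have hA : ∫ s in a..b, p s • (U' s - w' s + J (U s - w s)) =
        (∫ s in a..b, p s • (U' s + J (U s))) - ((∫ s in a..b, p s • F s)
          - ∫ s in a..b, p s • J (g 0 s - w s))
          - ∫ s in a..b, p s • (w' s - (F s - J (g 0 s))) := by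
      have i1 : IntervalIntegrable (fun s => p s • (U' s + J (U s))) volume a b :=
        hci (by fun_prop)
      have i2 : IntervalIntegrable (fun s => p s • F s) volume a b := hsm hpc hF
      have i3 : IntervalIntegrable (fun s => p s • J (g 0 s - w s)) volume a b := by
        refine hsm hpc ?_
        simp only [map_sub]
        exact hJg.sub (hci (by fun_prop))
      have i4 : IntervalIntegrable (fun s => p s • (w' s - (F s - J (g 0 s)))) volume a b :=
        hsm hpc ((hci hw'c).sub hζ')
      rw [← intervalIntegral.integral_sub i2 i3, ← intervalIntegral.integral_sub i1 (i2.sub i3),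
        ← intervalIntegral.integral_sub (i1.sub (i2.sub i3)) i4]
      refine intervalIntegral.integral_congr fun s _ => ?_
      simp only [map_sub]
      module
    rw [hA, hparts, ← hUeq]
    module

section Modal

variable {H : Type*} [NormedAddCommGroup H] [InnerProductSpace ℝ H]

/-- Coordinates `(⟪x,φ_k⟫, ω_k⁻¹ ⟪y,φ_k⟫)` of a pair `(x,y)` for the first `m` modes. -/
def modalCoords (φ : ℕ → H) (ω : ℕ → ℝ) (m : ℕ) :
    H × H →L[ℝ] EuclideanSpace ℝ (Fin m ⊕ Fin m) :=
  (PiLp.continuousLinearEquiv 2 ℝ (fun _ : Fin m ⊕ Fin m => ℝ)).symm.toContinuousLinearMap ∘L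
    ContinuousLinearMap.pi (Sum.elim
      (fun k : Fin m => innerSL ℝ (φ k) ∘L ContinuousLinearMap.fst ℝ H H)
      (fun k : Fin m => (ω k)⁻¹ • (innerSL ℝ (φ k) ∘L ContinuousLinearMap.snd ℝ H H)))

@[simp] lemma modalCoords_inl (φ : ℕ → H) (ω : ℕ → ℝ) (m : ℕ) (x : H × H) (k : Fin m) :
    modalCoords φ ω m x (Sum.inl k) = ⟪x.1, φ k⟫ := by
  simp [modalCoords, real_inner_comm]

@[simp] lemma modalCoords_inr (φ : ℕ → H) (ω : ℕ → ℝ) (m : ℕ) (x : H × H) (k : Fin m) :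
    modalCoords φ ω m x (Sum.inr k) = (ω k)⁻¹ * ⟪x.2, φ k⟫ := by
  simp [modalCoords, real_inner_comm]

/-- The skew-symmetric generator of the first `m` modes of the wave equation. -/
def modalRot (ω : ℕ → ℝ) (m : ℕ) :
    EuclideanSpace ℝ (Fin m ⊕ Fin m) →L[ℝ] EuclideanSpace ℝ (Fin m ⊕ Fin m) :=
  (PiLp.continuousLinearEquiv 2 ℝ (fun _ : Fin m ⊕ Fin m => ℝ)).symm.toContinuousLinearMap ∘L
    ContinuousLinearMap.pi (Sum.elim
      (fun k : Fin m => -(ω k • PiLp.proj (𝕜 := ℝ) 2 (fun _ : Fin m ⊕ Fin m => ℝ) (Sum.inr k)))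
      (fun k : Fin m => ω k • PiLp.proj (𝕜 := ℝ) 2 (fun _ : Fin m ⊕ Fin m => ℝ) (Sum.inl k)))

@[simp] lemma modalRot_inl (ω : ℕ → ℝ) (m : ℕ) (v : EuclideanSpace ℝ (Fin m ⊕ Fin m))
    (k : Fin m) : modalRot ω m v (Sum.inl k) = -(ω k * v (Sum.inr k)) := by
  simp [modalRot]

@[simp] lemma modalRot_inr (ω : ℕ → ℝ) (m : ℕ) (v : EuclideanSpace ℝ (Fin m ⊕ Fin m))
    (k : Fin m) : modalRot ω m v (Sum.inr k) = ω k * v (Sum.inl k) := by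
  simp [modalRot]

lemma inner_modalRot_self (ω : ℕ → ℝ) (m : ℕ) (v : EuclideanSpace ℝ (Fin m ⊕ Fin m)) :
    ⟪modalRot ω m v, v⟫ = 0 := by
  simp only [PiLp.inner_apply, Fintype.sum_sum_type, modalRot_inl, modalRot_inr]
  simp only [← Finset.sum_add_distrib]
  refine Finset.sum_eq_zero fun k _ => ?_
  simp
  ring

end Modal

lemma aForm_smul_basis {H : Type*} [NormedAddCommGroup H] [InnerProductSpace ℝ H]
    {φ : ℕ → H} (hφ : Orthonormal ℝ φ) (lam : ℕ → ℝ) (u : H) (r : ℝ) (k : ℕ) :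
    aForm φ lam u (r • φ k) = lam k * (r * ⟪u, φ k⟫) := by
  rw [aForm, aPow, tsum_eq_single k]
  · simp only [Real.rpow_one, inner_smul_left, orthonormal_iff_ite.1 hφ k k, if_true]
    simp
    ring
  · intro i hi
    simp [inner_smul_left, orthonormal_iff_ite.1 hφ k i, hi.symm]

@[simp] lemma aForm_zero_right {H : Type*} [NormedAddCommGroup H] [InnerProductSpace ℝ H]
    (φ : ℕ → H) (lam : ℕ → ℝ) (u : H) : aForm φ lam u 0 = 0 := by
  simp [aForm, aPow]

lemma memHs_smul_basis {H : Type*} [NormedAddCommGroup H] [InnerProductSpace ℝ H]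
    {φ : ℕ → H} (hφ : Orthonormal ℝ φ) (lam : ℕ → ℝ) (α r : ℝ) (k : ℕ) :
    MemHs φ lam α (r • φ k) := by
  refine summable_of_ne_finset_zero (s := {k}) fun i hi => ?_
  have hik : ¬ k = i := fun h => hi (by simp [h])
  simp [inner_smul_left, orthonormal_iff_ite.1 hφ k i, hik]

lemma memHs_zero {H : Type*} [NormedAddCommGroup H] [InnerProductSpace ℝ H]
    (φ : ℕ → H) (lam : ℕ → ℝ) (α : ℝ) : MemHs φ lam α 0 := by
  simp [MemHs, summable_zero]

lemma inner_Aop_basis {H : Type*} [NormedAddCommGroup H] [InnerProductSpace ℝ H] [CompleteSpace H]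
    {φ : ℕ → H} (hφ : Orthonormal ℝ φ) {lam : ℕ → ℝ} {u : H} (hu : MemHs φ lam 2 u) (k : ℕ) :
    ⟪Aop φ lam u, φ k⟫ = lam k * ⟪u, φ k⟫ := by
  have hsum : Summable fun i => (lam i * ⟪u, φ i⟫) • φ i := by
    have h := hφ.orthogonalFamily.summable_iff_norm_sq_summable (fun i => lam i * ⟪u, φ i⟫)
    simp only [LinearIsometry.toSpanSingleton_apply] at h
    rw [h]
    refine hu.congr fun i => ?_
    rw [Real.norm_eq_abs, sq_abs, mul_pow]
    norm_num
  have h := (innerSL ℝ (φ k)).hasSum hsum.hasSum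
  rw [real_inner_comm]
  have h' : HasSum (fun i => ⟪φ k, (lam i * ⟪u, φ i⟫) • φ i⟫) ⟪φ k, Aop φ lam u⟫ := h
  rw [← h'.tsum_eq, tsum_eq_single k]
  · simp [inner_smul_right, hφ.1 k]
  · intro i hi
    simp [inner_smul_right, orthonormal_iff_ite.1 hφ k i, hi.symm]

/-- The dG equations tested with one mode on one subinterval. -/
lemma dG_modal_equation {H : Type*} [NormedAddCommGroup H] [InnerProductSpace ℝ H]
    {φ : ℕ → H} (hφ : Orthonormal ℝ φ) {lam : ℕ → ℝ} {q N : ℕ} {tt : ℕ → ℝ} {f : ℝ → H}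
    {u0 v0 : H} {c1 c2 : ℕ → ℕ → H}
    (hdG : ∀ d1 d2 : ℕ → ℕ → H, (∀ n j, MemHs φ lam 1 (d1 n j)) →
        (∀ n j, MemHs φ lam 1 (d2 n j)) →
        Bform φ lam tt N q c1 c2 d1 d2 =
          (∑ n ∈ Finset.Icc 1 N, ∫ s in tt (n-1)..tt n, ⟪f s, pval q d2 n s⟫)
            + aForm φ lam u0 (pval q d1 1 (tt 0)) + ⟪v0, pval q d2 1 (tt 0)⟫)
    {l : ℕ} (hl : l < N) (k : ℕ) {p1 p2 : ℝ → ℝ} (hp1 : IsPolyFun (q + 1) p1)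
    (hp2 : IsPolyFun (q + 1) p2) :
    (∫ s in tt l..tt (l + 1), (lam k * (p1 s * ⟪pderiv q c1 (l + 1) s, φ k⟫)
        - lam k * (p1 s * ⟪pval q c2 (l + 1) s, φ k⟫)
        + p2 s * ⟪pderiv q c2 (l + 1) s, φ k⟫
        + lam k * (p2 s * ⟪pval q c1 (l + 1) s, φ k⟫)))
      + lam k * (p1 (tt l) *
          ⟪pval q c1 (l + 1) (tt l) - (if l = 0 then u0 else pval q c1 l (tt l)), φ k⟫)
      + p2 (tt l) * ⟪pval q c2 (l + 1) (tt l) - (if l = 0 then v0 else pval q c2 l (tt l)), φ k⟫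
      = ∫ s in tt l..tt (l + 1), p2 s * ⟪f s, φ k⟫ := by
  obtain ⟨e1, he1⟩ := hp1
  obtain ⟨e2, he2⟩ := hp2
  let D : (ℕ → ℝ) → ℕ → ℕ → H := fun e n j => if n = l + 1 then e j • φ k else 0
  have hD : ∀ e n j, MemHs φ lam 1 (D e n j) := by
    intro e n j
    by_cases h : n = l + 1
    · simpa [D, h] using memHs_smul_basis hφ lam 1 (e j) k
    · simpa [D, h] using memHs_zero φ lam 1
  have hDeq : ∀ e s, pval q (D e) (l + 1) s =
      (∑ j ∈ Finset.range (q + 1), s ^ j • e j) • φ k := by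
    intro e s
    simp [pval, D, Finset.sum_smul, smul_smul]
  have hDne : ∀ e n s, n ≠ l + 1 → pval q (D e) n s = 0 := by
    intro e n s hn
    simp [pval, D, hn]
  have h := hdG (D e1) (D e2) (hD e1) (hD e2)
  rw [Bform, Finset.sum_eq_single_of_mem (l + 1) (Finset.mem_Icc.2 ⟨by omega, hl⟩),
    Finset.sum_eq_single_of_mem (l + 1) (Finset.mem_Icc.2 ⟨by omega, hl⟩)] at h
  rotate_left
  · intro n _ hn
    simp [hDne _ _ _ hn]
  · intro n _ hn
    simp [hDne _ _ _ hn]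
  simp only [hDeq, ← he1, ← he2, Nat.add_sub_cancel, aForm_smul_basis hφ, inner_smul_right] at h
  rcases Nat.eq_zero_or_pos l with rfl | hpos
  · rw [Finset.sum_eq_zero] at h
    · simp only [zero_add] at h hDeq ⊢
      simp only [hDeq, ← he1, ← he2, aForm_smul_basis hφ, inner_smul_right] at h
      simp only [if_true, inner_sub_left]
      linarith
    · intro n hn
      have : n + 1 ≠ 0 + 1 := by
        have := (Finset.mem_Icc.1 hn).1
        omega
      simp [hDne _ _ _ this]
  · have h1 : (1 : ℕ) ≠ l + 1 := by omega
    rw [Finset.sum_eq_single_of_mem l (Finset.mem_Icc.2 ⟨hpos, by omega⟩)] at h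
    · simp only [hDne _ _ _ h1, hDeq, ← he1, ← he2, aForm_smul_basis hφ, inner_smul_right,
        aForm_zero_right, inner_zero_right, add_zero] at h
      simp only [hpos.ne', if_false]
      linarith
    · intro n _ hn
      have : n + 1 ≠ l + 1 := by omega
      simp [hDne _ _ _ this]

lemma norm_le_of_modes_le {H : Type*} [NormedAddCommGroup H] [InnerProductSpace ℝ H]
    [CompleteSpace H] {φ : ℕ → H} (hφ : Orthonormal ℝ φ)
    (hφtotal : (Submodule.span ℝ (Set.range φ)).topologicalClosure = ⊤) {v : H} {B : ℝ}
    (hB : 0 ≤ B) (h : ∀ m : ℕ, ∑ k : Fin m, ⟪v, φ k⟫ ^ 2 ≤ B ^ 2) : ‖v‖ ≤ B := by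
  have hs := (HilbertBasis.mk hφ hφtotal.ge).hasSum_inner_mul_inner v v
  rw [HilbertBasis.coe_mk, real_inner_self_eq_norm_sq] at hs
  refine le_of_sq_le_sq (le_of_tendsto' hs.tendsto_sum_nat fun m => ?_) hB
  rw [Finset.sum_range]
  refine le_trans (le_of_eq (Finset.sum_congr rfl fun k _ => ?_)) (h m)
  rw [real_inner_comm v (φ k), sq]

lemma norm_modalRot_modalCoords_le {H : Type*} [NormedAddCommGroup H] [InnerProductSpace ℝ H]
    {φ : ℕ → H} (hφ : Orthonormal ℝ φ) {lam : ℕ → ℝ} (hlam : ∀ k, 0 < lam k) {x y : H}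
    (hx : MemHs φ lam 1 x) (m : ℕ) :
    ‖modalRot (fun k => √(lam k)) m (modalCoords φ (fun k => √(lam k)) m (x, y))‖
      ≤ ‖y‖ + hsNorm φ lam 1 x := by
  have hnn : 0 ≤ hsNorm φ lam 1 x := Real.sqrt_nonneg _
  refine le_of_sq_le_sq ?_ (by positivity)
  rw [EuclideanSpace.real_norm_sq_eq, Fintype.sum_sum_type]
  have h1 : ∑ k : Fin m, ⟪y, φ k⟫ ^ 2 ≤ ‖y‖ ^ 2 := by
    have := hφ.sum_inner_products_le (x := y) (s := Finset.range m)
    rw [Finset.sum_range] at this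
    simpa [real_inner_comm] using this
  have h2 : ∑ k : Fin m, lam k * ⟪x, φ k⟫ ^ 2 ≤ hsNorm φ lam 1 x ^ 2 := by
    have hterm : ∀ k, 0 ≤ lam k ^ (1 : ℝ) * ⟪x, φ k⟫ ^ 2 := fun k =>
      mul_nonneg (Real.rpow_nonneg (hlam k).le _) (sq_nonneg _)
    rw [hsNorm, hsNormSq, Real.sq_sqrt (tsum_nonneg hterm)]
    have := hx.sum_le_tsum (Finset.range m) fun k _ => hterm k
    rw [Finset.sum_range] at this
    simpa using this
  have e1 : ∀ k : Fin m, (modalRot (fun k => √(lam k)) m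
      (modalCoords φ (fun k => √(lam k)) m (x, y)) (Sum.inl k)) ^ 2 = ⟪y, φ k⟫ ^ 2 := by
    intro k
    have : √(lam k) ≠ 0 := (Real.sqrt_pos.2 (hlam k)).ne'
    simp [mul_inv_cancel_left₀ this]
  have e2 : ∀ k : Fin m, (modalRot (fun k => √(lam k)) m
      (modalCoords φ (fun k => √(lam k)) m (x, y)) (Sum.inr k)) ^ 2 = lam k * ⟪x, φ k⟫ ^ 2 := by
    intro k
    simp [mul_pow, Real.sq_sqrt (hlam k).le]
  simp only [e1, e2]
  nlinarith [norm_nonneg y]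

lemma hasDerivAt_pval {H : Type*} [NormedAddCommGroup H] [InnerProductSpace ℝ H]
    (q : ℕ) (c : ℕ → ℕ → H) (n : ℕ) (s : ℝ) : HasDerivAt (pval q c n) (pderiv q c n s) s :=
  HasDerivAt.fun_sum fun j _ => (hasDerivAt_pow j s).smul_const (c n j)

/-- The dG equations on one subinterval in the coordinates of the first `m` modes. -/
lemma dG_modalCoords_equation {H : Type*} [NormedAddCommGroup H] [InnerProductSpace ℝ H]
    {φ : ℕ → H} (hφ : Orthonormal ℝ φ) {lam : ℕ → ℝ} (hlam : ∀ k, 0 < lam k)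
    {q N : ℕ} {tt : ℕ → ℝ} {f : ℝ → H} {u0 v0 : H} {c1 c2 : ℕ → ℕ → H}
    (hdG : ∀ d1 d2 : ℕ → ℕ → H, (∀ n j, MemHs φ lam 1 (d1 n j)) →
        (∀ n j, MemHs φ lam 1 (d2 n j)) →
        Bform φ lam tt N q c1 c2 d1 d2 =
          (∑ n ∈ Finset.Icc 1 N, ∫ s in tt (n-1)..tt n, ⟪f s, pval q d2 n s⟫)
            + aForm φ lam u0 (pval q d1 1 (tt 0)) + ⟪v0, pval q d2 1 (tt 0)⟫)
    {l : ℕ} (hl : l < N) (hf : IntervalIntegrable f volume (tt l) (tt (l + 1))) (m : ℕ)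
    {p : ℝ → ℝ} (hp : IsPolyFun (q + 1) p) :
    (∫ s in tt l..tt (l + 1), p s •
        (modalCoords φ (fun k => √(lam k)) m (pderiv q c1 (l + 1) s, pderiv q c2 (l + 1) s)
          + modalRot (fun k => √(lam k)) m (modalCoords φ (fun k => √(lam k)) m
            (pval q c1 (l + 1) s, pval q c2 (l + 1) s))))
      + p (tt l) • (modalCoords φ (fun k => √(lam k)) m
            (pval q c1 (l + 1) (tt l), pval q c2 (l + 1) (tt l))
          - modalCoords φ (fun k => √(lam k)) m
            (if l = 0 then u0 else pval q c1 l (tt l), if l = 0 then v0 else pval q c2 l (tt l)))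
      = ∫ s in tt l..tt (l + 1), p s • modalCoords φ (fun k => √(lam k)) m (0, f s) := by
  have hpc := hp.continuous
  have hder : ∀ c : ℕ → ℕ → H, Continuous (pderiv q c (l + 1)) := fun c => by
    unfold pderiv
    fun_prop
  have hval : ∀ c : ℕ → ℕ → H, Continuous (pval q c (l + 1)) := fun c => by
    unfold pval
    fun_prop
  have hd1 := hder c1
  have hd2 := hder c2
  have hv1 := hval c1
  have hv2 := hval c2
  have hFint : IntervalIntegrable (fun s => p s • modalCoords φ (fun k => √(lam k)) m (0, f s))
      volume (tt l) (tt (l + 1)) := by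
    refine IntervalIntegrable.continuousOn_smul ?_ hpc.continuousOn
    rw [intervalIntegrable_iff] at hf ⊢
    exact ((modalCoords φ (fun k => √(lam k)) m) ∘L
      ContinuousLinearMap.inr ℝ H H).integrable_comp hf
  have hUint : IntervalIntegrable (fun s => p s •
        (modalCoords φ (fun k => √(lam k)) m (pderiv q c1 (l + 1) s, pderiv q c2 (l + 1) s)
          + modalRot (fun k => √(lam k)) m (modalCoords φ (fun k => √(lam k)) m
            (pval q c1 (l + 1) s, pval q c2 (l + 1) s)))) volume (tt l) (tt (l + 1)) :=
    Continuous.intervalIntegrable (by fun_prop) _ _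
  have hcoord : ∀ {h : ℝ → EuclideanSpace ℝ (Fin m ⊕ Fin m)},
      IntervalIntegrable h volume (tt l) (tt (l + 1)) → ∀ i,
      (∫ s in tt l..tt (l + 1), h s) i = ∫ s in tt l..tt (l + 1), h s i := fun hh i =>
    ((PiLp.proj (𝕜 := ℝ) 2 (fun _ : Fin m ⊕ Fin m => ℝ) i).intervalIntegral_comp_comm hh).symm
  ext i
  rw [PiLp.add_apply, hcoord hFint, hcoord hUint]
  rcases i with k | k
  · have hω : √(lam k) ≠ 0 := (Real.sqrt_pos.2 (hlam k)).ne'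
    have h := dG_modal_equation hφ hdG hl k hp IsPolyFun.zero
    have hfac : ∀ s, lam k * (p s * ⟪pderiv q c1 (l + 1) s, φ k⟫)
        - lam k * (p s * ⟪pval q c2 (l + 1) s, φ k⟫) =
        lam k * (p s * (⟪pderiv q c1 (l + 1) s, φ k⟫ - ⟪pval q c2 (l + 1) s, φ k⟫)) :=
      fun s => by ring
    simp only [zero_mul, mul_zero, add_zero, intervalIntegral.integral_zero] at h
    simp only [hfac, intervalIntegral.integral_const_mul, ← mul_add] at h
    have h' := (mul_eq_zero.1 h).resolve_left (hlam k).ne'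
    simp only [PiLp.smul_apply, PiLp.add_apply, PiLp.sub_apply, modalCoords_inl, modalCoords_inr,
      modalRot_inl, mul_inv_cancel_left₀ hω, smul_eq_mul, inner_zero_left, mul_zero,
      intervalIntegral.integral_zero, ← sub_eq_add_neg, ← inner_sub_left] at h' ⊢
    exact h'
  · have hω : √(lam k) ≠ 0 := (Real.sqrt_pos.2 (hlam k)).ne'
    have h := dG_modal_equation hφ hdG hl k IsPolyFun.zero hp
    have hlω : lam k = √(lam k) * √(lam k) := (Real.mul_self_sqrt (hlam k).le).symm
    have hfac : ∀ s, p s * ⟪pderiv q c2 (l + 1) s, φ k⟫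
        + lam k * (p s * ⟪pval q c1 (l + 1) s, φ k⟫) =
        √(lam k) * (p s * ((√(lam k))⁻¹ * ⟪pderiv q c2 (l + 1) s, φ k⟫
          + √(lam k) * ⟪pval q c1 (l + 1) s, φ k⟫)) := by
      intro s
      rw [hlω]
      simp only [Real.sqrt_mul_self (Real.sqrt_nonneg _)]
      field_simp
    have hfacF : ∀ s, p s * ⟪f s, φ k⟫ = √(lam k) * (p s * ((√(lam k))⁻¹ * ⟪f s, φ k⟫)) :=
      fun s => by field_simp
    simp only [zero_mul, mul_zero, sub_zero, zero_add, add_zero] at h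
    simp_rw [hfac] at h
    rw [intervalIntegral.integral_congr fun s _ => hfacF s] at h
    simp only [intervalIntegral.integral_const_mul] at h
    simp only [PiLp.smul_apply, PiLp.add_apply, PiLp.sub_apply, modalCoords_inl, modalCoords_inr,
      modalRot_inr, smul_eq_mul]
    apply mul_left_cancel₀ hω
    rw [← h, inner_sub_left]
    field_simp

/-- **Theorem 4.1, second estimate (nodal L₂ error of dG(q) for the displacement).**
`‖e_{1,N}^-‖ ≤ C Σₙ kₙ^{q+1} ∫_{Iₙ} (‖u₂^{(q+1)}‖ + ‖u₁^{(q+1)}‖₁)`. -/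
theorem dG_nodal_error_L2
    {H : Type*} [NormedAddCommGroup H] [InnerProductSpace ℝ H] [CompleteSpace H]
    (φ : ℕ → H) (lam : ℕ → ℝ)
    (hφ : Orthonormal ℝ φ)
    (hφtotal : (Submodule.span ℝ (Set.range φ)).topologicalClosure = ⊤)
    (hlam_pos : ∀ k, 0 < lam k) (hlam_mono : Monotone lam)
    (hlam_top : Filter.Tendsto lam Filter.atTop Filter.atTop)
    (q : ℕ) :
    ∃ C : ℝ, 0 < C ∧
      ∀ (T : ℝ), 0 < T → ∀ (N : ℕ), 1 ≤ N →
      ∀ tt : ℕ → ℝ, tt 0 = 0 → tt N = T → (∀ n < N, tt n < tt (n + 1)) →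
      -- data
      ∀ f : ℝ → H, IntervalIntegrable f volume 0 T →
      ∀ u0 v0 : H, MemHs φ lam 1 u0 →
      -- exact solution (u₁,u₂)
      ∀ u1 u2 : ℝ → H,
      u1 0 = u0 → u2 0 = v0 →
      ContinuousOn u1 (Set.Icc 0 T) → ContinuousOn u2 (Set.Icc 0 T) →
      (∀ t, MemHs φ lam 2 (u1 t)) → (∀ t, MemHs φ lam 1 (u2 t)) →
      (∀ t ∈ Set.Ioo 0 T, HasDerivAt u1 (u2 t) t) →
      (∀ t ∈ Set.Ioo 0 T, HasDerivAt u2 (f t - Aop φ lam (u1 t)) t) →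
      -- temporal regularity of the exact solution
      (∀ m < q + 1, ∀ t ∈ Set.Ioo 0 T,
        HasDerivAt (iteratedDeriv m u1) (iteratedDeriv (m+1) u1 t) t) →
      (∀ m < q + 1, ∀ t ∈ Set.Ioo 0 T,
        HasDerivAt (iteratedDeriv m u2) (iteratedDeriv (m+1) u2 t) t) →
      (∀ t, MemHs φ lam 1 (iteratedDeriv (q+1) u1 t)) →
      IntervalIntegrable (fun t => hsNorm φ lam 1 (iteratedDeriv (q+1) u1 t)) volume 0 T →
      IntervalIntegrable (fun t => ‖iteratedDeriv (q+1) u2 t‖) volume 0 T →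
      -- the dG(q) approximation U = (U₁,U₂) ∈ 𝒱_q (coefficient families c1, c2)
      ∀ c1 c2 : ℕ → ℕ → H,
      (∀ n j, MemHs φ lam 1 (c1 n j)) → (∀ n j, MemHs φ lam 1 (c2 n j)) →
      (∀ d1 d2 : ℕ → ℕ → H, (∀ n j, MemHs φ lam 1 (d1 n j)) →
        (∀ n j, MemHs φ lam 1 (d2 n j)) →
        Bform φ lam tt N q c1 c2 d1 d2 =
          (∑ n ∈ Finset.Icc 1 N, ∫ s in tt (n-1)..tt n, ⟪f s, pval q d2 n s⟫)
            + aForm φ lam u0 (pval q d1 1 (tt 0)) + ⟪v0, pval q d2 1 (tt 0)⟫) →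
      ‖pval q c1 N (tt N) - u1 (tt N)‖
        ≤ C * ∑ n ∈ Finset.Icc 1 N, (tt n - tt (n-1)) ^ (q+1) *
            ∫ s in tt (n-1)..tt n,
              (‖iteratedDeriv (q+1) u2 s‖
                + hsNorm φ lam 1 (iteratedDeriv (q+1) u1 s)) := by
  obtain ⟨K, hK, hstep⟩ := dG_step_error q
  refine ⟨K, hK, ?_⟩
  intro T hT N hN tt ht0 htN htlt f hf u0 v0 _ u1 u2 hu10 hu20 hu1c hu2c hu1A _ hu1' hu2' hd1 hd2
    hmem hint1 hint2 c1 c2 _ _ hdG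
  have hmono : MonotoneOn tt (Set.Iic N) :=
    (strictMonoOn_Iic_of_lt_succ fun n hn => htlt n hn).monotoneOn
  have hpos : ∀ n ≤ N, 0 ≤ tt n := fun n hn =>
    ht0 ▸ hmono (Set.mem_Iic.2 (Nat.zero_le N)) hn (Nat.zero_le n)
  have hleT : ∀ n ≤ N, tt n ≤ T := fun n hn => htN ▸ hmono hn (Set.mem_Iic.2 le_rfl) hn
  set β : ℝ → ℝ := fun s =>
    ‖iteratedDeriv (q + 1) u2 s‖ + hsNorm φ lam 1 (iteratedDeriv (q + 1) u1 s) with hβ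
  have hβ0 : ∀ s, 0 ≤ β s := fun s => add_nonneg (norm_nonneg _) (Real.sqrt_nonneg _)
  have hsub : ∀ l < N, Set.uIcc (tt l) (tt (l + 1)) ⊆ Set.uIcc 0 T := by
    intro l hl
    rw [Set.uIcc_of_le (htlt l hl).le, Set.uIcc_of_le hT.le]
    exact Set.Icc_subset_Icc (hpos l hl.le) (hleT (l + 1) hl)
  have hβint : IntervalIntegrable β volume 0 T := hint2.add hint1
  have hsum0 : 0 ≤ K * ∑ n ∈ Finset.Icc 1 N, (tt n - tt (n - 1)) ^ (q + 1) *
      ∫ s in tt (n - 1)..tt n, β s := by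
    refine mul_nonneg hK.le (Finset.sum_nonneg fun n hn => ?_)
    obtain ⟨hn1, hnN⟩ := Finset.mem_Icc.1 hn
    have hle : tt (n - 1) ≤ tt n := hmono (Set.mem_Iic.2 (by omega)) hnN (Nat.sub_le n 1)
    exact mul_nonneg (pow_nonneg (sub_nonneg.2 hle) _)
      (intervalIntegral.integral_nonneg hle fun s _ => hβ0 s)
  refine norm_le_of_modes_le hφ hφtotal hsum0 fun m => ?_
  set M := modalCoords φ (fun k => √(lam k)) m with hM
  set J := modalRot (fun k => √(lam k)) m with hJ
  have hnode : ∀ n ≤ N, ‖M (if n = 0 then u0 else pval q c1 n (tt n),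
        if n = 0 then v0 else pval q c2 n (tt n)) - M (u1 (tt n), u2 (tt n))‖
      ≤ K * ∑ i ∈ Finset.Icc 1 n, (tt i - tt (i - 1)) ^ (q + 1) *
          ∫ s in tt (i - 1)..tt i, β s := by
    intro n
    induction n with
    | zero => simp [ht0, hu10, hu20]
    | succ l ih =>
      intro hl
      have hIoo : Set.Ioo (tt l) (tt (l + 1)) ⊆ Set.Ioo 0 T :=
        Set.Ioo_subset_Ioo (hpos l (by omega)) (hleT (l + 1) hl)
      have hIcc : Set.Icc (tt l) (tt (l + 1)) ⊆ Set.Icc 0 T :=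
        Set.Icc_subset_Icc (hpos l (by omega)) (hleT (l + 1) hl)
      have hMd : ∀ {x y : ℝ → H} {x' y' : H} {t : ℝ}, HasDerivAt x x' t → HasDerivAt y y' t →
          HasDerivAt (fun t => M (x t, y t)) (M (x', y')) t := fun hx hy =>
        M.hasFDerivAt.comp_hasDerivAt _ (hx.prodMk hy)
      have hstep' := hstep J (inner_modalRot_self _ m) (htlt l hl) (hβint.mono_set (hsub l hl))
        (fun n t => M (iteratedDeriv n u1 t, iteratedDeriv n u2 t))
        (by
          simp only [iteratedDeriv_zero]
          exact M.continuous.comp_continuousOn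
            ((hu1c.mono hIcc).prodMk (hu2c.mono hIcc)))
        (fun n hn t ht => hMd (hd1 n hn t (hIoo ht)) (hd2 n hn t (hIoo ht)))
        (fun t _ => norm_modalRot_modalCoords_le hφ hlam_pos (hmem t) m)
        (F := fun t => M (0, f t))
        (by
          have h := hf.mono_set (hsub l hl)
          rw [intervalIntegrable_iff] at h ⊢
          exact (M ∘L ContinuousLinearMap.inr ℝ H H).integrable_comp h)
        (by
          intro t ht
          simp only [iteratedDeriv_zero]
          refine (hMd (hu1' t (hIoo ht)) (hu2' t (hIoo ht))).congr_deriv ?_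
          ext i
          rcases i with k | k
          · have hω : √(lam k) ≠ 0 := (Real.sqrt_pos.2 (hlam_pos k)).ne'
            simp [hM, hJ, mul_inv_cancel_left₀ hω]
          · have hω : √(lam k) ≠ 0 := (Real.sqrt_pos.2 (hlam_pos k)).ne'
            simp only [hM, hJ, PiLp.sub_apply, modalCoords_inl, modalCoords_inr, modalRot_inr,
              inner_sub_left, inner_Aop_basis hφ (hu1A t)]
            field_simp
            rw [Real.sq_sqrt (hlam_pos k).le])
        (U := fun s => M (pval q c1 (l + 1) s, pval q c2 (l + 1) s))
        ⟨fun j => M (c1 (l + 1) j, c2 (l + 1) j), fun s => by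
          simp only [pval, ← map_smul, ← map_sum, Prod.smul_mk]
          congr 1
          ext <;> simp [Prod.fst_sum, Prod.snd_sum]⟩
        (fun s => hMd (hasDerivAt_pval q c1 (l + 1) s) (hasDerivAt_pval q c2 (l + 1) s))
        (fun p hp => dG_modalCoords_equation hφ hlam_pos hdG hl
          (hf.mono_set (hsub l hl)) m hp)
      rw [Finset.sum_Icc_succ_top (by omega), mul_add]
      simp only [iteratedDeriv_zero] at hstep'
      simpa using hstep'.trans (add_le_add_left (ih (by omega)) _)
  have hfinal := hnode N le_rfl
  have hN0 : N ≠ 0 := by omega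
  simp only [hN0, if_false, ← map_sub, Prod.mk_sub_mk] at hfinal
  refine le_trans ?_ (pow_le_pow_left₀ (norm_nonneg _) hfinal 2)
  rw [EuclideanSpace.real_norm_sq_eq, Fintype.sum_sum_type]
  simp only [hM, modalCoords_inl]
  exact le_add_of_nonneg_right (Finset.sum_nonneg fun k _ => sq_nonneg _)
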